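/- arXiv:1401.5001 — 9 statements merged into one kernel-verified Lean document; each statement's English description precedes it below -/
import Mathlib

section
/- Let G be a group, H ≤ G a subgroup, K ⊴ G a normal subgroup, and A a type with an action of the group H. Write N_H^G A for the set of functions a : G → A such that a(h·g) = h • a(g) for all h ∈ H and g ∈ G, with G acting by (k • a)(g) = a(g·k). Then the map Δ, which sends a function b : G/K → A satisfying b(h·x) = h • b(x) for all h ∈ H, x ∈ G/K and whose values are fixed by every h ∈ H with h ∈ K, to the function Δ(b) : G → A defined by Δ(b)(g) = b(gK), is a bijection onto the set of those a ∈ N_H^G A with a(g·k) = a(g) for all k ∈ K and g ∈ G (the K-fixed points of N_H^G A). Moreover Δ is equivariant for right translation: for every g₀ ∈ G, Δ(x ↦ b(x·g₀K))(g) = Δ(b)(g·g₀) for all g ∈ G. -/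
/-- The set-level diagonal map for the norm: for a group `G`, subgroup `H`, normal
subgroup `K`, and an `H`-action on `A`, the map `Δ` sending `b : G ⧸ K → A`
(`H`-equivariant with `H ∩ K`-fixed values) to `g ↦ b ⟦g⟧` is a bijection onto the
`K`-fixed points of the norm `N_H^G A`, equivariantly for right translation. -/
theorem stmt_0 {G : Type*} [Group G] (H K : Subgroup G) [K.Normal]
    {A : Type*} [MulAction H A] :
    (∃ e : {b : G ⧸ K → A //
          (∀ (h : H) (g : G),
            b (QuotientGroup.mk ((h : G) * g)) = h • b (QuotientGroup.mk g)) ∧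
          (∀ h : H, (h : G) ∈ K → ∀ x : G ⧸ K, h • b x = b x)} ≃
        {a : G → A //
          (∀ (h : H) (g : G), a ((h : G) * g) = h • a g) ∧
          (∀ (g : G), ∀ k ∈ K, a (g * k) = a g)},
      ∀ b g, (e b).1 g = b.1 (QuotientGroup.mk g)) ∧
    (∀ (b : G ⧸ K → A) (g₀ g : G),
      b (QuotientGroup.mk g * QuotientGroup.mk g₀) = b (QuotientGroup.mk (g * g₀))) := by
  refine ⟨⟨{
    toFun := fun b => ⟨fun g => b.1 (QuotientGroup.mk g), fun h g => b.2.1 h g, fun g k hk => by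
      exact congrArg b.1 (QuotientGroup.mk_mul_of_mem g hk)⟩
    invFun := fun a => ⟨fun x => Quotient.liftOn' x a.1 (fun g g' hg => by
      have h1 := a.2.2 g (g⁻¹ * g') (QuotientGroup.leftRel_apply.mp hg)
      rw [mul_inv_cancel_left] at h1
      exact h1.symm), fun h g => a.2.1 h g, fun h hh x => by
        induction x using QuotientGroup.induction_on with
        | H g =>
          change h • a.1 g = a.1 g
          rw [← a.2.1 h g]
          have h1 := a.2.2 g (g⁻¹ * (h : G) * g) (by
            simpa using Subgroup.Normal.conj_mem (inferInstance : K.Normal) (h : G) hh g⁻¹)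
          rw [← h1]
          congr 1
          group⟩
    left_inv := fun b => by
      apply Subtype.ext
      funext x
      induction x using QuotientGroup.induction_on with
      | H g => rfl
    right_inv := fun a => rfl }, fun b g => rfl⟩, fun b g₀ g => rfl⟩
end

section
/- Fix a prime p. Suppose given, for every natural number n and every commutative ring R, a ring homomorphism ψ_{n,R} : W_n(R) → W_n(R) of the ring of length-n p-typical truncated Witt vectors, such that: (i) naturality — for every ring homomorphism f : R → S one has W_n(f) ∘ ψ_{n,R} = ψ_{n,S} ∘ W_n(f), where W_n(f) is the induced map on truncated Witt vectors; and (ii) compatibility with restriction — for every n and R, truncate ∘ ψ_{n+1,R} = ψ_{n,R} ∘ truncate, where truncate : W_{n+1}(R) → W_n(R) is the truncation ring homomorphism. Then ψ_{n,R} is the identity for every n and every commutative ring R. -/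
namespace WittRigid

open WittVector Polynomial

theorem ghost_expand {p : ℕ} [Fact p.Prime] {R : Type*} [CommRing R] (n : ℕ)
    (x : WittVector p R) :
    ghostComponent n x = ∑ i ∈ Finset.range (n + 1), (p : R) ^ i * x.coeff i ^ p ^ (n - i) := by
  rw [ghostComponent_apply, aeval_wittPolynomial]

theorem ghost_nat {p : ℕ} [Fact p.Prime] {R S : Type*} [CommRing R] [CommRing S] (f : R →+* S)
    (n : ℕ) (x : WittVector p R) :
    ghostComponent n (WittVector.map f x) = f (ghostComponent n x) := by
  simp [ghost_expand, map_sum]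

theorem ghost_diff {p : ℕ} [Fact p.Prime] {R : Type*} [CommRing R] (n : ℕ)
    (x y : WittVector p R) (h : ∀ i < n, x.coeff i = y.coeff i) :
    ghostComponent n x = ghostComponent n y + (p : R) ^ n * (x.coeff n - y.coeff n) := by
  rw [ghost_expand, ghost_expand, Finset.sum_range_succ, Finset.sum_range_succ]
  rw [Finset.sum_congr rfl (g := fun i => (p : R) ^ i * y.coeff i ^ p ^ (n - i))]
  · simp
    ring
  · intro i hi
    rw [h i (Finset.mem_range.1 hi)]

theorem ghost_coeff {p : ℕ} [hp : Fact p.Prime] {R : Type*} [CommRing R] [IsDomain R] [CharZero R]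
    (n : ℕ) (x y : WittVector p R) (h : ∀ i < n, x.coeff i = y.coeff i)
    (hg : ghostComponent n x = ghostComponent n y) : x.coeff n = y.coeff n := by
  have h1 := ghost_diff n x y h
  rw [hg] at h1
  have h2 : (p : R) ^ n * (x.coeff n - y.coeff n) = 0 := by linear_combination -h1
  have h3 : (p : R) ^ n ≠ 0 := pow_ne_zero _ (Nat.cast_ne_zero.2 hp.1.ne_zero)
  exact sub_eq_zero.1 ((mul_eq_zero.1 h2).resolve_left h3)

theorem ghost_inj {p : ℕ} [hp : Fact p.Prime] {R : Type*} [CommRing R] [IsDomain R] [CharZero R]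
    (x y : WittVector p R) (hg : ∀ n, ghostComponent n x = ghostComponent n y) : x = y := by
  ext n
  induction n using Nat.strong_induction_on with
  | _ n ih => exact ghost_coeff n x y ih (hg n)

theorem ghost_V {p : ℕ} [hp : Fact p.Prime] {R : Type*} [CommRing R] (j k : ℕ)
    (x : WittVector p R) :
    ghostComponent (j + k) (verschiebung^[j] x) = (p : R) ^ j * ghostComponent k x := by
  induction j with
  | zero => simp
  | succ j ih =>
    rw [Function.iterate_succ_apply', show j + 1 + k = (j + k) + 1 by ring,
      ghostComponent_verschiebung, ih]
    ring

theorem ghost_V_lt {p : ℕ} [hp : Fact p.Prime] {R : Type*} [CommRing R] (j n : ℕ) (h : n < j)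
    (x : WittVector p R) :
    ghostComponent n (verschiebung^[j] x) = 0 := by
  rw [ghost_expand]
  apply Finset.sum_eq_zero
  intro i hi
  rw [iterate_verschiebung_coeff_eq_zero _ (by have := Finset.mem_range.1 hi; omega)]
  rw [zero_pow (pow_ne_zero _ hp.1.ne_zero), mul_zero]

theorem map_V {p : ℕ} [hp : Fact p.Prime] {R S : Type*} [CommRing R] [CommRing S] (f : R →+* S)
    (j : ℕ) (x : WittVector p R) :
    WittVector.map f (verschiebung^[j] x) = verschiebung^[j] (WittVector.map f x) := by
  induction j with
  | zero => simp
  | succ j ih => rw [Function.iterate_succ_apply', Function.iterate_succ_apply',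
      map_verschiebung, ih]

theorem V_sub {p : ℕ} [hp : Fact p.Prime] {R : Type*} [CommRing R]
    (j : ℕ) (x y : WittVector p R) :
    verschiebung^[j] (x - y) = verschiebung^[j] x - verschiebung^[j] y := by
  induction j with
  | zero => simp
  | succ j ih => simp only [Function.iterate_succ_apply', ih, map_sub]

theorem V_natmul {p : ℕ} [hp : Fact p.Prime] {R : Type*} [CommRing R]
    (j m : ℕ) (x : WittVector p R) :
    verschiebung^[j] (m • x) = m • verschiebung^[j] x := by
  induction j with
  | zero => simp
  | succ j ih => simp only [Function.iterate_succ_apply', ih, map_nsmul]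

theorem exists_V {p : ℕ} [hp : Fact p.Prime] {R : Type*} [CommRing R]
    (x : WittVector p R) (h : x.coeff 0 = 0) : ∃ y, x = verschiebung y :=
  ⟨_, by simpa using eq_iterate_verschiebung (x := x) (n := 1) (by simpa using h)⟩

theorem coeff_zero_sub {p : ℕ} [hp : Fact p.Prime] {R : Type*} [CommRing R]
    (x y : WittVector p R) : (x - y).coeff 0 = x.coeff 0 - y.coeff 0 :=
  (constantCoeff : WittVector p R →+* R).map_sub x y

theorem V_teich {p : ℕ} [hp : Fact p.Prime] {R : Type*} [CommRing R] [IsDomain R] [CharZero R]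
    (j : ℕ) (t : R) :
    verschiebung^[j] (teichmuller p (t ^ p ^ j)) = verschiebung^[j] 1 * teichmuller p t := by
  apply ghost_inj
  intro n
  rw [map_mul]
  rcases lt_or_ge n j with h | h
  · rw [ghost_V_lt _ _ h, ghost_V_lt _ _ h, zero_mul]
  · obtain ⟨k, rfl⟩ := Nat.exists_eq_add_of_le h
    rw [ghost_V, ghost_V, ghostComponent_teichmuller, ghostComponent_teichmuller, map_one]
    ring

theorem V_one_sq {p : ℕ} [hp : Fact p.Prime] {R : Type*} [CommRing R] [IsDomain R] [CharZero R]
    (j : ℕ) :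
    (verschiebung^[j] 1 : WittVector p R) * verschiebung^[j] 1 =
      (p : WittVector p R) ^ j * verschiebung^[j] 1 := by
  apply ghost_inj
  intro n
  rw [map_mul, map_mul]
  rcases lt_or_ge n j with h | h
  · rw [ghost_V_lt _ _ h]; simp
  · obtain ⟨k, rfl⟩ := Nat.exists_eq_add_of_le h
    rw [ghost_V]; simp

section core

universe u

variable {p : ℕ} [hp : Fact p.Prime]

/-- the agreement subring -/
noncomputable def E (Ψ : ∀ (R : Type u) [CommRing R], WittVector p R →+* WittVector p R) (n : ℕ)
    (R : Type u) [CommRing R] : Subring (WittVector p R) :=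
  RingHom.eqLocus ((truncate n).comp (Ψ R)) (truncate n)

theorem mem_E (Ψ : ∀ (R : Type u) [CommRing R], WittVector p R →+* WittVector p R) (n : ℕ)
    (R : Type u) [CommRing R] (x : WittVector p R) :
    x ∈ E Ψ n R ↔ ∀ i < n, (Ψ R x).coeff i = x.coeff i := by
  change truncate n (Ψ R x) = truncate n x ↔ _
  rw [TruncatedWittVector.ext_iff, Fin.forall_iff]
  simp only [coeff_truncate]

theorem core_step (Ψ : ∀ (R : Type u) [CommRing R], WittVector p R →+* WittVector p R)
    (hnat : ∀ (R S : Type u) [CommRing R] [CommRing S] (f : R →+* S) (x : WittVector p R),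
      WittVector.map f (Ψ R x) = Ψ S (WittVector.map f x))
    (hcont : ∀ (n : ℕ) (R : Type u) [CommRing R] (x y : WittVector p R),
      (∀ i < n, x.coeff i = y.coeff i) → ∀ i < n, (Ψ R x).coeff i = (Ψ R y).coeff i)
    (A : Type u) [CommRing A] [IsDomain A] [CharZero A] (hpA : ¬ (p : A) ∣ 1)
    (h2A : Function.Injective (fun k : ℕ => (2 : A) ^ k))
    (hA : ∀ (R : Type u) [CommRing R], Nonempty (A →+* R))
    (n : ℕ)
    (ih : ∀ (R : Type u) [CommRing R] (x : WittVector p R), ∀ i < n, (Ψ R x).coeff i = x.coeff i)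
    (R : Type u) [CommRing R] (x : WittVector p R) : x ∈ E Ψ (n + 1) R := by
  have Emap : ∀ (R S : Type u) [CommRing R] [CommRing S] (f : R →+* S) (x : WittVector p R),
      x ∈ E Ψ (n + 1) R → WittVector.map f x ∈ E Ψ (n + 1) S := by
    intro R S _ _ f x hx
    rw [mem_E] at hx ⊢
    intro i hi
    rw [← hnat, map_coeff, map_coeff, hx i hi]
  have Einj : ∀ (R S : Type u) [CommRing R] [CommRing S] (f : R →+* S) (x : WittVector p R),
      Function.Injective f → WittVector.map f x ∈ E Ψ (n + 1) S → x ∈ E Ψ (n + 1) R := by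
    intro R S _ _ f x hf hx
    rw [mem_E] at hx ⊢
    intro i hi
    have := hx i hi
    rw [← hnat, map_coeff, map_coeff] at this
    exact hf this
  have Eghost : ∀ (R : Type u) [CommRing R] [IsDomain R] [CharZero R] (x : WittVector p R),
      ghostComponent n (Ψ R x) = ghostComponent n x → x ∈ E Ψ (n + 1) R := by
    intro R _ _ _ x hx
    rw [mem_E]
    intro i hi
    rcases Nat.lt_succ_iff_lt_or_eq.1 hi with h | rfl
    · exact ih R x i h
    · exact ghost_coeff _ _ _ (ih R x) hx
  have ghostE : ∀ (R : Type u) [CommRing R] (x : WittVector p R),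
      x ∈ E Ψ (n + 1) R → ghostComponent n (Ψ R x) = ghostComponent n x := by
    intro R _ x hx
    rw [mem_E] at hx
    rw [ghost_diff n _ _ (ih R x), hx n (Nat.lt_succ_self n)]
    simp
  have EV : ∀ (R : Type u) [CommRing R] (x : WittVector p R),
      verschiebung^[n + 1] x ∈ E Ψ (n + 1) R := by
    intro R _ x
    rw [mem_E]
    have h0 : ∀ i < n + 1, (verschiebung^[n + 1] x).coeff i = (0 : WittVector p R).coeff i := by
      intro i hi
      rw [iterate_verschiebung_coeff_eq_zero _ hi, zero_coeff]
    intro i hi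
    rw [hcont (n + 1) R _ 0 h0 i hi, h0 i hi, map_zero]
  -- Step 1
  have S1X : teichmuller p (X : A[X]) ∈ E Ψ (n + 1) A[X] := by
    apply Eghost
    rw [ghostComponent_teichmuller]
    set f : A[X] := ghostComponent n (Ψ A[X] (teichmuller p X)) with hf
    have hF : ∀ t : A[X], ghostComponent n (Ψ A[X] (teichmuller p t)) = f.comp t := by
      intro t
      have h1 := hnat A[X] A[X] (compRingHom t) (teichmuller p X)
      rw [map_teichmuller] at h1
      have h2 : compRingHom t (X : A[X]) = t := by simp
      rw [h2] at h1
      rw [← h1, ghost_nat, ← hf]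
      simp
    have hf1 : f.eval 1 = 1 := by
      have h1 := hF 1
      rw [map_one, map_one, map_one, ← C_1, comp_C] at h1
      exact (C_injective h1).symm
    have hf2 : ∀ k, f.coeff k ≠ 0 → (2 : A) ^ k = f.eval 2 := by
      intro k hk
      have h1 := hF (C 2 * X)
      rw [map_mul, map_mul, map_mul, hF, hF, comp_C, comp_X] at h1
      have h2 := congrArg (fun q : A[X] => Polynomial.coeff q k) h1
      simp only [coeff_C_mul, comp_C_mul_X_coeff] at h2
      apply mul_left_cancel₀ hk
      rw [← h2, mul_comm]
    have hne : f.coeff (p ^ n) ≠ 0 := by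
      rcases Nat.eq_zero_or_pos n with rfl | hn
      · have h2 := hF (C 2)
        rw [comp_C] at h2
        have h3 : ghostComponent 0 (Ψ A[X] (teichmuller p (C 2))) = C (2 : A) := by
          have h4 : ∀ x : WittVector p A[X], ghostComponent 0 x = x.coeff 0 := by
            intro x; rw [ghost_expand]; simp
          rw [h4, hcont 1 A[X] _ 2 _ 0 one_pos, map_ofNat (Ψ A[X]) 2, ← h4,
            map_ofNat (ghostComponent (p := p) (R := A[X]) 0) 2, C_ofNat]
          intro i hi
          obtain rfl : i = 0 := by omega
          rw [teichmuller_coeff_zero, ← h4, map_ofNat (ghostComponent (p := p) (R := A[X]) 0) 2, C_ofNat]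
        rw [h3] at h2
        have h5 : (2 : A) = f.eval 2 := C_injective h2
        have hf0 : f ≠ 0 := by
          intro h
          rw [h] at hf1
          simp at hf1
        obtain ⟨k, hk⟩ : ∃ k, f.coeff k ≠ 0 := by
          by_contra hcon
          push Not at hcon
          exact hf0 (Polynomial.ext (by simpa using hcon))
        have h6 := hf2 k hk
        rw [← h5] at h6
        have : k = 1 := h2A (by simpa using h6)
        subst this
        simpa using hk
      · have h1 := ghost_diff n _ _ (ih A[X] (teichmuller p X))
        rw [← hf, ghostComponent_teichmuller] at h1
        intro h0
        rw [h1, coeff_add, coeff_X_pow, if_pos rfl] at h0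
        set g := (Ψ A[X] (teichmuller p X)).coeff n - (teichmuller p X).coeff n
        have h2 : ((p : A[X]) ^ n * g).coeff (p ^ n) = (p : A) ^ n * g.coeff (p ^ n) := by
          rw [← coeff_C_mul]
          simp
        rw [h2] at h0
        apply hpA
        obtain ⟨m, rfl⟩ := Nat.exists_eq_succ_of_ne_zero hn.ne'
        refine ⟨-((p : A) ^ m * g.coeff (p ^ (m + 1))), ?_⟩
        rw [Nat.succ_eq_add_one, pow_succ] at h0
        linear_combination h0
    have h2 := hf2 _ hne
    have hmon : f = C (f.coeff (p ^ n)) * X ^ p ^ n := by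
      ext k
      rw [coeff_C_mul, coeff_X_pow]
      split_ifs with hk
      · rw [hk, mul_one]
      · rw [mul_zero]
        by_contra hk2
        exact hk (h2A ((hf2 k hk2).trans h2.symm))
    have hc : f.coeff (p ^ n) = 1 := by
      rw [hmon] at hf1
      simpa using hf1
    rw [hmon, hc]
    simp
  have liftX : ∀ (R : Type u) [CommRing R] (t : R), ∃ f : A[X] →+* R, f X = t := by
    intro R _ t
    obtain ⟨g⟩ := hA R
    exact ⟨eval₂RingHom g t, by simp⟩
  -- Step 2
  have S2 : ∀ j, verschiebung^[j] 1 ∈ E Ψ (n + 1) A → ∀ (R : Type u) [CommRing R] (t : R),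
      verschiebung^[j] (teichmuller p t) ∈ E Ψ (n + 1) R := by
    intro j hj R _ t
    have h1 : verschiebung^[j] (1 : WittVector p A[X]) ∈ E Ψ (n + 1) A[X] := by
      have := Emap _ _ (C : A →+* A[X]) _ hj
      rwa [map_V, map_one] at this
    have h2 := (E Ψ (n + 1) A[X]).mul_mem h1 S1X
    rw [← V_teich] at h2
    have h3 : verschiebung^[j] (teichmuller p (X : A[X])) ∈ E Ψ (n + 1) A[X] := by
      apply Einj _ _ (expand A (p ^ j) : A[X] →+* A[X])
      · exact expand_injective (pow_pos hp.1.pos j)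
      · rw [map_V, map_teichmuller]
        simpa using h2
    obtain ⟨f, hf⟩ := liftX R t
    have := Emap _ _ f _ h3
    rwa [map_V, map_teichmuller, hf] at this
  have gV1 : ∀ j ≤ n, ghostComponent n (verschiebung^[j] (1 : WittVector p A)) = (p : A) ^ j := by
    intro j hj
    obtain ⟨k, rfl⟩ := Nat.exists_eq_add_of_le hj
    rw [ghost_V, map_one, mul_one]
  have hp0 : (p : A) ≠ 0 := Nat.cast_ne_zero.2 hp.1.ne_zero
  have S2lt : ∀ j < n, verschiebung^[j] 1 ∈ E Ψ (n + 1) A := by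
    intro j hj
    apply Eghost
    rw [gV1 j hj.le]
    have h1 := congrArg (fun y => ghostComponent n (Ψ A y)) (V_one_sq (p := p) (R := A) j)
    simp only [map_mul, map_pow, map_natCast] at h1
    have h2 := ghost_diff n _ _ (ih A (verschiebung^[j] 1))
    rw [gV1 j hj.le] at h2
    by_cases h0 : ghostComponent n (Ψ A (verschiebung^[j] 1)) = 0
    · exfalso
      rw [h0] at h2
      obtain ⟨k, rfl⟩ := Nat.exists_eq_add_of_lt hj
      set g := (Ψ A (verschiebung^[j] 1)).coeff (j + k + 1) -
        (verschiebung^[j] (1 : WittVector p A)).coeff (j + k + 1)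
      apply hpA
      refine ⟨-((p : A) ^ k * g), ?_⟩
      apply mul_left_cancel₀ (pow_ne_zero j hp0)
      linear_combination -h2
    · exact mul_right_cancel₀ h0 h1
  have S2n : verschiebung^[n] 1 ∈ E Ψ (n + 1) A := by
    rcases Nat.eq_zero_or_pos n with hn | hn
    · subst hn
      exact (E Ψ 1 A).one_mem
    obtain ⟨m, rfl⟩ := Nat.exists_eq_succ_of_ne_zero hn.ne'
    rw [Nat.succ_eq_add_one] at *
    have hm := S2lt m (Nat.lt_succ_self m)
    have h1 : verschiebung^[m] (2 • (1 : WittVector p A)) ∈ E Ψ (m + 1 + 1) A := by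
      rw [V_natmul]
      exact (E Ψ (m + 1 + 1) A).nsmul_mem hm 2
    have h2 := (E Ψ (m + 1 + 1) A).sub_mem h1 (S2 m hm A 2)
    rw [← V_sub] at h2
    obtain ⟨y, hy⟩ := exists_V (2 • (1 : WittVector p A) - teichmuller p 2) (by
      rw [coeff_zero_sub, teichmuller_coeff_zero]
      have : (2 • (1 : WittVector p A)).coeff 0 = 2 := by
        change WittVector.constantCoeff (2 • (1 : WittVector p A)) = 2
        rw [map_nsmul, map_one]
        simp
      rw [this, sub_self])
    have hy1 : (2 : A) - 2 ^ p = p * ghostComponent 0 y := by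
      rw [← ghostComponent_verschiebung, ← hy, map_sub, ghostComponent_teichmuller,
        map_nsmul, map_one]
      simp
    have hy0 : ghostComponent 0 y ≠ 0 := by
      intro h
      rw [h, mul_zero, sub_eq_zero] at hy1
      have : 1 = p := h2A (by simpa using hy1)
      exact hp.1.one_lt.ne this
    rw [hy, ← Function.iterate_succ_apply] at h2
    obtain ⟨c, hc⟩ := exists_V (p • y - (2 • (1 : WittVector p A) - 2 ^ p • 1)) (by
      have h4 : ∀ x : WittVector p A, x.coeff 0 = ghostComponent 0 x := by
        intro x; rw [ghost_expand]; simp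
      rw [h4, map_sub, map_sub, map_nsmul, map_nsmul, map_nsmul, map_one, nsmul_eq_mul, ← hy1]
      simp)
    have h4 := EV A c
    rw [Function.iterate_succ_apply, ← hc, V_sub, V_sub, V_natmul, V_natmul, V_natmul] at h4
    have h5 := (E Ψ (m + 1 + 1) A).sub_mem ((E Ψ (m + 1 + 1) A).nsmul_mem h2 p) h4
    rw [Nat.succ_eq_add_one, sub_sub_cancel] at h5
    have h6 := ghostE _ _ h5
    simp only [map_sub, map_nsmul] at h6
    apply Eghost
    have h7 : (2 : A) - 2 ^ p ≠ 0 := by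
      rw [hy1]
      exact mul_ne_zero hp0 hy0
    apply mul_left_cancel₀ h7
    simp only [nsmul_eq_mul, Nat.cast_pow, Nat.cast_ofNat] at h6
    linear_combination h6
  -- Step 4
  have S4 : ∀ k ≤ n + 1, ∀ y : WittVector p R, verschiebung^[n + 1 - k] y ∈ E Ψ (n + 1) R := by
    intro k
    induction k with
    | zero => intro _ y; exact EV R y
    | succ k ihk =>
      intro hk y
      obtain ⟨c, hc⟩ := exists_V (y - teichmuller p (y.coeff 0)) (by
        rw [coeff_zero_sub, teichmuller_coeff_zero, sub_self])
      have h1 : verschiebung^[n + 1 - (k + 1)] (teichmuller p (y.coeff 0)) ∈ E Ψ (n + 1) R := by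
        apply S2
        rcases Nat.eq_zero_or_pos k with rfl | h
        · simpa using S2n
        · exact S2lt _ (by omega)
      have h2 := ihk (by omega) c
      rw [show n + 1 - k = (n + 1 - (k + 1)) + 1 by omega, Function.iterate_succ_apply, ← hc,
        V_sub] at h2
      have := (E Ψ (n + 1) R).add_mem h2 h1
      rwa [sub_add_cancel] at this
  simpa using S4 (n + 1) le_rfl x

theorem core (Ψ : ∀ (R : Type u) [CommRing R], WittVector p R →+* WittVector p R)
    (hnat : ∀ (R S : Type u) [CommRing R] [CommRing S] (f : R →+* S) (x : WittVector p R),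
      WittVector.map f (Ψ R x) = Ψ S (WittVector.map f x))
    (hcont : ∀ (n : ℕ) (R : Type u) [CommRing R] (x y : WittVector p R),
      (∀ i < n, x.coeff i = y.coeff i) → ∀ i < n, (Ψ R x).coeff i = (Ψ R y).coeff i)
    (n : ℕ) :
    ∀ (R : Type u) [CommRing R] (x : WittVector p R), ∀ i < n, (Ψ R x).coeff i = x.coeff i := by
  let e : ULift.{u} ℤ ≃+* ℤ := ULift.ringEquiv
  have : IsDomain (ULift.{u} ℤ) := MulEquiv.isDomain ℤ e.toMulEquiv
  have : CharZero (ULift.{u} ℤ) := charZero_of_injective_ringHom (f := e.symm.toRingHom) e.symm.injective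
  induction n with
  | zero => intro R _ x i hi; omega
  | succ n ih =>
    intro R _ x
    rw [← mem_E]
    refine core_step Ψ hnat hcont (ULift.{u} ℤ) ?_ ?_ ?_ n ih R x
    · intro h
      have h1 := map_dvd e h
      rw [map_natCast, map_one] at h1
      have h2 : p ∣ 1 := by exact_mod_cast h1
      exact hp.1.one_lt.ne' (Nat.dvd_one.1 h2)
    · intro a b hab
      have h1 : ((2 ^ a : ℕ) : ULift.{u} ℤ) = ((2 ^ b : ℕ) : ULift.{u} ℤ) := by
        push_cast
        exact hab
      exact Nat.pow_right_injective le_rfl (Nat.cast_injective h1)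
    · intro R _
      exact ⟨(Int.castRingHom R).comp e.toRingHom⟩

end core

end WittRigid


/-- Rigidity for natural endomorphisms of truncated Witt vectors: any family of ring
homomorphisms `ψ n R : W_n(R) →+* W_n(R)`, natural in the commutative ring `R`
(where the induced map `W_n(f)` is characterized by commuting with the projections
from the full Witt vectors via `WittVector.map f`) and compatible with the
truncation (restriction) maps `W_{n+1}(R) → W_n(R)`, is the identity. -/
theorem stmt_2 (p : ℕ) [Fact p.Prime]
    (ψ : ∀ (n : ℕ) (R : Type u) [CommRing R],
      TruncatedWittVector p n R →+* TruncatedWittVector p n R)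
    (hnat : ∀ (n : ℕ) (R S : Type u) [CommRing R] [CommRing S] (f : R →+* S)
      (F : TruncatedWittVector p n R →+* TruncatedWittVector p n S),
      F.comp (WittVector.truncate n) = (WittVector.truncate n).comp (WittVector.map f) →
      F.comp (ψ n R) = (ψ n S).comp F)
    (hres : ∀ (n : ℕ) (R : Type u) [CommRing R],
      (TruncatedWittVector.truncate (Nat.le_succ n)).comp (ψ (n + 1) R) =
        (ψ n R).comp (TruncatedWittVector.truncate (Nat.le_succ n)))
    (n : ℕ) (R : Type u) [CommRing R] (x : TruncatedWittVector p n R) :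
    ψ n R x = x := by
  have compat : ∀ (R : Type u) [CommRing R] (k₁ k₂ : ℕ) (hk : k₁ ≤ k₂),
      (TruncatedWittVector.truncate hk).comp ((ψ k₂ R).comp (WittVector.truncate k₂)) =
        (ψ k₁ R).comp (WittVector.truncate (p := p) k₁) := by
    intro R _ k₁ k₂ hk
    induction k₂, hk using Nat.le_induction with
    | base =>
      ext1 x
      apply TruncatedWittVector.ext
      intro i
      simp [TruncatedWittVector.coeff_truncate]
    | succ k₂ hk ih =>
      rw [← ih]
      ext1 x
      have h1 := RingHom.congr_fun (hres k₂ R) (WittVector.truncate (k₂ + 1) x)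
      simp only [RingHom.comp_apply, TruncatedWittVector.truncate_wittVector_truncate] at h1 ⊢
      rw [← h1, TruncatedWittVector.truncate_truncate]
  let Ψ : ∀ (R : Type u) [CommRing R], WittVector p R →+* WittVector p R :=
    fun R _ => WittVector.lift _ (compat R)
  have hΨ : ∀ (R : Type u) [CommRing R] (k : ℕ) (y : WittVector p R),
      WittVector.truncate k (Ψ R y) = ψ k R (WittVector.truncate k y) := by
    intro R _ k y
    exact WittVector.truncate_lift k (compat R) y
  have htr : ∀ (R : Type u) [CommRing R] (k : ℕ) (y z : WittVector p R),
      WittVector.truncate k y = WittVector.truncate k z ↔ ∀ i < k, y.coeff i = z.coeff i := by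
    intro R _ k y z
    rw [TruncatedWittVector.ext_iff, Fin.forall_iff]
    simp only [WittVector.coeff_truncate]
  have key := WittRigid.core Ψ ?_ ?_ n R
  · obtain ⟨y, rfl⟩ := WittVector.truncate_surjective p n R x
    rw [← hΨ, htr]
    exact key y
  · intro R S _ _ f y
    ext k
    refine (htr S (k + 1) _ _).1 ?_ k (Nat.lt_succ_self k)
    let F : TruncatedWittVector p (k + 1) R →+* TruncatedWittVector p (k + 1) S :=
      RingHom.liftOfSurjective (WittVector.truncate (k + 1))
        (WittVector.truncate_surjective p (k + 1) R)
        ⟨(WittVector.truncate (k + 1)).comp (WittVector.map f), by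
          intro z hz
          rw [WittVector.mem_ker_truncate] at hz
          rw [RingHom.mem_ker, RingHom.comp_apply, ← RingHom.mem_ker, WittVector.mem_ker_truncate]
          intro i hi
          rw [WittVector.map_coeff, hz i hi, map_zero]⟩
    have hF : F.comp (WittVector.truncate (k + 1)) =
        (WittVector.truncate (k + 1)).comp (WittVector.map f) :=
      RingHom.liftOfRightInverse_comp _ _ _ _
    have h1 := RingHom.congr_fun (hnat (k + 1) R S f F hF) (WittVector.truncate (k + 1) y)
    have h2 := fun z => RingHom.congr_fun hF z
    simp only [RingHom.comp_apply] at h1 h2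
    rw [← hΨ, h2, h2, ← hΨ] at h1
    exact h1
  · intro k R _ y z h
    rw [← htr] at h ⊢
    rw [hΨ, hΨ, h]
end

section
/- Fix a natural number m. Suppose given, for every commutative ℚ-algebra R, a ring homomorphism Φ_R : (Fin m → R) → (Fin m → R) of the product ring R^m, natural in R in the sense that for every ring homomorphism f : R → S between commutative ℚ-algebras, applying f coordinatewise commutes with Φ, i.e., (f applied in each coordinate) ∘ Φ_R = Φ_S ∘ (f applied in each coordinate). Then there exists a function σ : Fin m → Fin m such that Φ_R(a) = a ∘ σ for every commutative ℚ-algebra R and every a : Fin m → R. -/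
/-- Any natural ring endomorphism of the product functor `R ↦ R^m` on commutative
`ℚ`-algebras is given by reindexing the coordinates: there is a function
`σ : Fin m → Fin m` with `Φ_R a = a ∘ σ` for all `R` and `a`. -/
theorem stmt_3 (m : ℕ)
    (Φ : ∀ (R : Type u) [CommRing R] [Algebra ℚ R], (Fin m → R) →+* (Fin m → R))
    (hnat : ∀ (R S : Type u) [CommRing R] [CommRing S] [Algebra ℚ R] [Algebra ℚ S]
      (f : R →+* S) (a : Fin m → R),
      Φ S (fun i => f (a i)) = fun i => f (Φ R a i)) :
    ∃ σ : Fin m → Fin m, ∀ (R : Type u) [CommRing R] [Algebra ℚ R] (a : Fin m → R),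
      Φ R a = a ∘ σ := by
  classical
  have key1 : ∀ j : Fin m, ∃ i : Fin m, Φ (ULift.{u} ℚ) (Pi.single i 1) j = 1 := by
    intro j
    by_contra! h
    have h0 : ∀ i, Φ (ULift.{u} ℚ) (Pi.single i 1) j = 0 := by
      intro i
      have hid : IsIdempotentElem (Φ (ULift.{u} ℚ) (Pi.single i 1) j) := by
        unfold IsIdempotentElem
        rw [← Pi.mul_apply, ← map_mul, ← Pi.single_mul, one_mul]
      exact (IsIdempotentElem.iff_eq_zero_or_one.mp hid).resolve_right (h i)
    have h1 : (∑ i : Fin m, Pi.single i (1 : ULift.{u} ℚ) : Fin m → ULift.{u} ℚ) = 1 :=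
      Finset.univ_sum_single (1 : Fin m → ULift.{u} ℚ)
    have h2 := congrFun (congrArg (Φ (ULift.{u} ℚ)) h1) j
    rw [map_sum, map_one, Finset.sum_apply] at h2
    simp [h0] at h2
  choose σ hσ using key1
  refine ⟨σ, ?_⟩
  have hcz : Function.Injective (Nat.cast : ℕ → ULift.{u} ℚ) :=
    fun a b h => Nat.cast_injective (R := ℚ) (congrArg ULift.down h)
  have hX : ∀ j : Fin m, Φ (Polynomial (ULift.{u} ℚ)) (fun _ => Polynomial.X) j = Polynomial.X := by
    intro j
    apply Polynomial.eq_of_infinite_eval_eq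
    refine Set.Infinite.mono ?_
      (Set.infinite_range_of_injective hcz)
    rintro _ ⟨n, rfl⟩
    have := congrFun (hnat (Polynomial (ULift.{u} ℚ)) (ULift.{u} ℚ)
      (Polynomial.evalRingHom (n : ULift.{u} ℚ)) (fun _ => Polynomial.X)) j
    simp only [Polynomial.coe_evalRingHom, Polynomial.eval_X] at this
    simp only [Set.mem_ofPred_eq, Polynomial.eval_X]
    rw [← this]
    exact congrFun (map_natCast (Φ (ULift.{u} ℚ)) n) j
  intro R _ _ a
  let g : ULift.{u} ℚ →+* R := (algebraMap ℚ R).comp (ULift.ringEquiv (R := ℚ)).toRingHom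
  have hc : ∀ (c : R) (j : Fin m), Φ R (fun _ => c) j = c := by
    intro c j
    have := congrFun (hnat (Polynomial (ULift.{u} ℚ)) R
      (Polynomial.eval₂RingHom g c) (fun _ => Polynomial.X)) j
    simpa [hX] using this
  funext j
  have he : Φ R (Pi.single (σ j) 1) j = 1 := by
    have := congrFun (hnat (ULift.{u} ℚ) R g (Pi.single (σ j) 1)) j
    rw [hσ j, map_one] at this
    refine Eq.trans ?_ this
    refine congrFun (congrArg (Φ R) ?_) j
    funext i
    by_cases h : i = σ j
    · subst h; simp
    · simp [Pi.single_eq_of_ne h]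
  have hm : a * Pi.single (σ j) 1 = (fun _ => a (σ j)) * Pi.single (σ j) 1 := by
    funext i
    by_cases h : i = σ j
    · subst h; simp
    · simp [Pi.single_eq_of_ne h]
  have h3 := congrFun (congrArg (Φ R) hm) j
  rw [map_mul, map_mul, Pi.mul_apply, Pi.mul_apply, he, mul_one, mul_one, hc] at h3
  exact h3
end

section
/- Let p be a prime, T a commutative ring, and σ a ring automorphism of T with σ^p = id. For x ∈ T set N(x) = ∏_{k=0}^{p−1} σ^k(x) and for w ∈ T set Tr(w) = ∑_{k=0}^{p−1} σ^k(w). Then for all x, y ∈ T there exists w ∈ T such that N(x+y) = N(x) + N(y) + Tr(w). -/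
theorem aux_shift_sum (p : ℕ) [Fact p.Prime] (k : ZMod p) (S : Finset (ZMod p))
    (h0 : S ≠ ∅) (h1 : S ≠ Finset.univ) :
    (∑ i ∈ S.map (addRightEmbedding k), i) / ((S.map (addRightEmbedding k)).card : ZMod p)
      = (∑ i ∈ S, i) / (S.card : ZMod p) + k := by
  have hc : (S.card : ZMod p) ≠ 0 := by
    rw [Ne, ZMod.natCast_eq_zero_iff]
    intro hd
    have h2 : S.card < p := by
      have := (Finset.card_lt_iff_ne_univ S).2 h1
      rwa [ZMod.card] at this
    have h3 : 0 < S.card := Finset.card_pos.2 (Finset.nonempty_iff_ne_empty.2 h0)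
    exact absurd (Nat.le_of_dvd h3 hd) (by omega)
  simp only [Finset.sum_map, Finset.card_map, addRightEmbedding_apply, Finset.sum_add_distrib,
    Finset.sum_const, nsmul_eq_mul]
  field_simp

theorem aux_range (p : ℕ) [NeZero p] {M : Type*} [CommMonoid M] (f : ℕ → M) :
    ∏ k ∈ Finset.range p, f k = ∏ i : ZMod p, f i.val := by
  refine Finset.prod_bij' (fun k _ => (k : ZMod p)) (fun i _ => i.val) ?_ ?_ ?_ ?_ ?_
  · simp
  · intro i _; simpa using ZMod.val_lt i
  · intro k hk; exact ZMod.val_cast_of_lt (Finset.mem_range.1 hk)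
  · intro i _; simp
  · intro k hk; rw [ZMod.val_cast_of_lt (Finset.mem_range.1 hk)]

theorem aux_range_add (p : ℕ) [NeZero p] {M : Type*} [AddCommMonoid M] (f : ℕ → M) :
    ∑ k ∈ Finset.range p, f k = ∑ i : ZMod p, f i.val :=
  aux_range (M := Multiplicative M) p f

/-- For a ring automorphism `σ` of a commutative ring `T` with `σ ^ p = 1` (`p` prime),
the multiplicative norm `N x = ∏_{k<p} σ^k x` is additive up to a transfer:
`N (x + y) = N x + N y + ∑_{k<p} σ^k w` for some `w`. -/
theorem stmt_5 (p : ℕ) (hp : p.Prime) {T : Type*} [CommRing T]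
    (σ : T ≃+* T) (hσ : σ ^ p = 1) (x y : T) :
    ∃ w : T,
      (∏ k ∈ Finset.range p, (σ ^ k) (x + y)) =
        (∏ k ∈ Finset.range p, (σ ^ k) x) + (∏ k ∈ Finset.range p, (σ ^ k) y) +
          ∑ k ∈ Finset.range p, (σ ^ k) w := by
  classical
  haveI : Fact p.Prime := ⟨hp⟩
  simp only [aux_range, aux_range_add]
  have hF : ∀ (k i : ZMod p) (a : T), (σ ^ k.val) ((σ ^ i.val) a) = (σ ^ (i + k).val) a := by
    intro k i a
    rw [← RingAut.mul_apply, ← pow_add, ZMod.val_add, ← pow_mod_orderOf, ← pow_mod_orderOf σ (_ % p),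
      Nat.mod_mod_of_dvd _ (orderOf_dvd_of_pow_eq_one hσ), add_comm]
  let t : Finset (ZMod p) → T := fun S =>
    (∏ i ∈ S, (σ ^ i.val) x) * ∏ i ∈ Sᶜ, (σ ^ i.val) y
  have ht : ∀ (k : ZMod p) S, (σ ^ k.val) (t S) = t (S.map (addRightEmbedding k)) := by
    intro k S
    have hc : (S.map (addRightEmbedding k))ᶜ = Sᶜ.map (addRightEmbedding k) := by
      ext i
      simp [← eq_sub_iff_add_eq]
    simp only [t, hc, map_mul, map_prod, hF, Finset.prod_map, addRightEmbedding_apply]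
  let q : Finset (ZMod p) → ZMod p := fun S => (∑ i ∈ S, i) / (S.card : ZMod p)
  let P : Finset (Finset (ZMod p)) := (Finset.univ.erase ∅).erase Finset.univ
  have hP : ∀ S, S ∈ P ↔ S ≠ Finset.univ ∧ S ≠ ∅ := by intro S; simp [P]
  have hsh : ∀ (k : ZMod p) S, S ∈ P → S.map (addRightEmbedding k) ∈ P := by
    intro k S
    simp only [hP, ← Finset.card_lt_iff_ne_univ, Finset.card_map, Ne, Finset.map_eq_empty]
    exact id
  have hq : ∀ (k : ZMod p) S, S ∈ P → q (S.map (addRightEmbedding k)) = q S + k :=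
    fun k S h => aux_shift_sum p k S ((hP S).1 h).2 ((hP S).1 h).1
  have hmm : ∀ (k l : ZMod p) (S : Finset (ZMod p)), k + l = 0 →
      (S.map (addRightEmbedding k)).map (addRightEmbedding l) = S := by
    intro k l S h
    ext i
    simp [add_assoc, h]
  refine ⟨∑ S ∈ P with q S = 0, t S, ?_⟩
  have hmain : ∑ S ∈ P, t S = ∑ k : ZMod p, (σ ^ k.val) (∑ S ∈ P with q S = 0, t S) := by
    rw [← Finset.sum_fiberwise P q t]
    refine Finset.sum_congr rfl fun k _ => ?_
    rw [map_sum]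
    symm
    refine Finset.sum_bij' (fun S _ => S.map (addRightEmbedding k))
      (fun S _ => S.map (addRightEmbedding (-k))) ?_ ?_ ?_ ?_ ?_
    · intro S hS
      rw [Finset.mem_filter] at hS ⊢
      exact ⟨hsh _ _ hS.1, by rw [hq _ _ hS.1, hS.2, zero_add]⟩
    · intro S hS
      rw [Finset.mem_filter] at hS ⊢
      exact ⟨hsh _ _ hS.1, by rw [hq _ _ hS.1, hS.2, add_neg_cancel]⟩
    · intro S _; exact hmm _ _ _ (by ring)
    · intro S _; exact hmm _ _ _ (by ring)
    · intro S _; exact ht k S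
  rw [← hmain]
  simp only [map_add]
  rw [Fintype.prod_add]
  change ∑ S, t S = _
  rw [← Finset.add_sum_erase _ t (Finset.mem_univ ∅),
    ← Finset.add_sum_erase (Finset.univ.erase ∅) t (a := Finset.univ) (by simp [Finset.univ_nonempty.ne_empty])]
  simp only [t, P, Finset.compl_empty, Finset.compl_univ, Finset.prod_empty]
  ring
end

section
/- Let p be a prime, T a commutative ring, and σ a ring automorphism of T with σ^p = id. For x ∈ T set N(x) = ∏_{k=0}^{p−1} σ^k(x) and for w ∈ T set Tr(w) = ∑_{k=0}^{p−1} σ^k(w). Let I ⊆ T be the ideal generated by the set of all transfers {Tr(w) : w ∈ T}, and let q : T → T/I be the quotient map. Then the function x ↦ q(N(x)) is the underlying function of a ring homomorphism T → T/I; that is, q(N(x+y)) = q(N(x)) + q(N(y)), q(N(x·y)) = q(N(x))·q(N(y)), and q(N(1)) = 1. -/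
/-- Powers of the automorphism indexed by `ZMod p`. -/
theorem aux_pow_add (p : ℕ) [NeZero p] {T : Type*} [CommRing T]
    (σ : T ≃+* T) (hσ : σ ^ p = 1) (a b : ZMod p) (x : T) :
    (σ ^ (a + b).val) x = (σ ^ a.val) ((σ ^ b.val) x) := by
  rw [← RingAut.mul_apply, ← pow_add, ZMod.val_add, ← pow_eq_pow_mod _ hσ]

theorem aux_range_val (p : ℕ) [NeZero p] {M : Type*} [CommMonoid M] (f : ℕ → M) :
    ∏ k ∈ Finset.range p, f k = ∏ k : ZMod p, f k.val := by
  symm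
  refine Finset.prod_bij (fun k _ => k.val) ?_ ?_ ?_ ?_
  · intro k _; exact Finset.mem_range.2 (ZMod.val_lt k)
  · intro a _ b _ h; exact ZMod.val_injective p h
  · intro b hb; exact ⟨(b : ZMod p), Finset.mem_univ _, ZMod.val_cast_of_lt (Finset.mem_range.1 hb)⟩
  · intro _ _; rfl

theorem aux_range_val_sum (p : ℕ) [NeZero p] {M : Type*} [AddCommMonoid M] (f : ℕ → M) :
    ∑ k ∈ Finset.range p, f k = ∑ k : ZMod p, f k.val :=
  aux_range_val (M := Multiplicative M) p f

theorem aux_main (p : ℕ) [Fact p.Prime] {T : Type*} [CommRing T]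
    (s : ZMod p → T →+* T) (hs : ∀ a b x, s (a + b) x = s a (s b x)) (I : Ideal T)
    (hI : ∀ w, ∑ k, s k w ∈ I) (x y : T) :
    ∏ k, s k (x + y) - (∏ k, s k x + ∏ k, s k y) ∈ I := by
  classical
  let m : Finset (ZMod p) → T := fun S => ∏ i, if i ∈ S then s i x else s i y
  let t : ZMod p → Finset (ZMod p) ≃ Finset (ZMod p) := fun c => (Equiv.addLeft c).finsetCongr
  have ht : ∀ c S i, c + i ∈ t c S ↔ i ∈ S := by
    intro c S i; simp [t]
  have htc : ∀ c S, (t c S).card = S.card := by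
    intro c S; simp [t]
  have hm : ∀ c S, m (t c S) = s c (m S) := by
    intro c S
    simp only [m, map_prod]
    rw [← Equiv.prod_comp (Equiv.addLeft c)]
    refine Finset.prod_congr rfl fun i _ => ?_
    simp only [Equiv.coe_addLeft, ht, hs]
    split_ifs <;> rfl
  have h1 : ∏ k, s k (x + y) = ∑ S, m S := by
    simp only [map_add, Finset.prod_add, Finset.powerset_univ]
    refine Finset.sum_congr rfl fun S _ => ?_
    simp only [m]
    rw [Finset.prod_ite]
    congr 1
    · apply Finset.prod_congr _ fun _ _ => rfl
      ext; simp
    · apply Finset.prod_congr _ fun _ _ => rfl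
      ext; simp
  let P : Finset (Finset (ZMod p)) := (Finset.univ.erase Finset.univ).erase ∅
  have h2 : ∑ S, m S = ∏ k, s k y + (∏ k, s k x + ∑ S ∈ P, m S) := by
    rw [← Finset.add_sum_erase _ _ (Finset.mem_univ (Finset.univ : Finset (ZMod p))),
      ← Finset.add_sum_erase (Finset.univ.erase Finset.univ) _ (a := ∅)]
    · simp only [m, Finset.mem_univ, if_true, Finset.notMem_empty, if_false, P]
      ring
    · simp [Finset.univ_nonempty.ne_empty.symm]
  have hP : ∀ S, S ∈ P ↔ 0 < S.card ∧ S.card < p := by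
    intro S
    have := Finset.card_lt_iff_ne_univ S
    rw [ZMod.card] at this
    simp [P, Finset.card_pos, Finset.nonempty_iff_ne_empty, this]
  let E : Finset (ZMod p) → ZMod p := fun S => (∑ i ∈ S, i) * (S.card : ZMod p)⁻¹
  have hE : ∀ c, ∀ S ∈ P, E (t c S) = c + E S := by
    intro c S hS
    have h0 : (S.card : ZMod p) ≠ 0 := by
      rw [Ne, ZMod.natCast_eq_zero_iff]
      exact Nat.not_dvd_of_pos_of_lt ((hP S).1 hS).1 ((hP S).1 hS).2
    simp only [E, htc]
    have : ∑ i ∈ t c S, i = S.card * c + ∑ i ∈ S, i := by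
      simp only [t, Equiv.finsetCongr_apply, Finset.sum_map, Equiv.coe_toEmbedding, Equiv.coe_addLeft]
      refine Finset.sum_add_distrib.trans ?_
      rw [Finset.sum_const, nsmul_eq_mul]
    rw [this]; field_simp
  have h3 : ∑ S ∈ P, m S = ∑ S ∈ P with E S = 0, ∑ c, s c (m S) := by
    rw [← Finset.sum_fiberwise P E, Finset.sum_comm]
    refine Finset.sum_congr rfl fun c _ => ?_
    symm
    have hPt : ∀ S, t c S ∈ P ↔ S ∈ P := by intro S; rw [hP, hP, htc]
    refine Finset.sum_equiv (t c) ?_ ?_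
    · intro S
      simp only [Finset.mem_filter, hPt]
      refine and_congr_right fun h => ?_
      rw [hE c S h]; simp
    · intro S _; exact (hm c S).symm
  have h4 : ∏ k, s k (x + y) - (∏ k, s k x + ∏ k, s k y) = ∑ S ∈ P with E S = 0, ∑ c, s c (m S) := by
    rw [h1, h2, h3]; ring
  rw [h4]
  exact Ideal.sum_mem _ fun S _ => hI _

/-- For a ring automorphism `σ` of a commutative ring `T` with `σ ^ p = 1` (`p` prime),
the norm `N x = ∏_{k<p} σ^k x` becomes a ring homomorphism `T → T/I` after composing
with the quotient by the ideal `I` generated by the transfers `Tr w = ∑_{k<p} σ^k w`. -/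
theorem stmt_6 (p : ℕ) (hp : p.Prime) {T : Type*} [CommRing T]
    (σ : T ≃+* T) (hσ : σ ^ p = 1) :
    let N : T → T := fun x => ∏ k ∈ Finset.range p, (σ ^ k) x
    let Tr : T → T := fun w => ∑ k ∈ Finset.range p, (σ ^ k) w
    let I : Ideal T := Ideal.span (Set.range Tr)
    let q := Ideal.Quotient.mk I
    (∀ x y : T, q (N (x + y)) = q (N x) + q (N y)) ∧
      (∀ x y : T, q (N (x * y)) = q (N x) * q (N y)) ∧
      q (N 1) = 1 := by
  intro N Tr I q
  haveI : Fact p.Prime := ⟨hp⟩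
  refine ⟨fun x y => ?_, fun x y => ?_, ?_⟩
  · rw [← map_add, Ideal.Quotient.eq]
    simp only [N, aux_range_val]
    refine aux_main p (fun k => ((σ ^ k.val : T ≃+* T) : T →+* T))
      (fun a b x => aux_pow_add p σ hσ a b x) I (fun w => ?_) x y
    apply Ideal.subset_span
    exact ⟨w, aux_range_val_sum p (fun k => (σ ^ k) w)⟩
  · rw [← map_mul]
    simp only [N, map_mul, Finset.prod_mul_distrib]
  · simp [N]
end

section
/- Let R be a commutative ring, M an R-module, and p a prime. Let T = ⨂_{i : Fin p} M be the p-fold tensor power of M over R (the PiTensorProduct of the constant family), let σ : T ≃ T be the R-linear automorphism given by reindexing the tensor factors along the cyclic rotation of Fin p, and for x ∈ M write x^{⊗p} ∈ T for the pure tensor of the constant family with value x. Then for all x, y ∈ M there exists w ∈ T such that (x+y)^{⊗p} = x^{⊗p} + y^{⊗p} + ∑_{k=0}^{p−1} σ^k(w). -/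
open scoped TensorProduct

theorem aux_orbits {α R T : Type*} [DecidableEq α] [CommRing R] [AddCommGroup T] [Module R T]
    (p : ℕ) (hp : p.Prime) (g : α → α) (hg : ∀ a, g^[p] a = a) (σ : T ≃ₗ[R] T) (F : α → T)
    (hF : ∀ a, F (g a) = σ (F a)) (n : ℕ) : ∀ A : Finset α, A.card = n → (∀ a ∈ A, g a ∈ A) →
    (∀ a ∈ A, g a ≠ a) → ∃ w : T, ∑ a ∈ A, F a = ∑ k ∈ Finset.range p, (σ ^ k) w := by
  have hFk : ∀ k a, F (g^[k] a) = (σ ^ k) (F a) := by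
    intro k
    induction k with
    | zero => intro a; simp
    | succ k ih => intro a; rw [Function.iterate_succ_apply, ih, hF, pow_succ]; rfl
  induction n using Nat.strong_induction_on with
  | _ n ih =>
    intro A hA hinv hfix
    rcases A.eq_empty_or_nonempty with rfl | ⟨a, ha⟩
    · exact ⟨0, by simp⟩
    have hmin : Function.minimalPeriod g a = p := by
      have hd : Function.minimalPeriod g a ∣ p :=
        Function.IsPeriodicPt.minimalPeriod_dvd (hg a)
      rcases (Nat.dvd_prime hp).1 hd with h | h
      · exact absurd (Function.minimalPeriod_eq_one_iff_isFixedPt.1 h) (hfix a ha)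
      · exact h
    have hinj : Set.InjOn (fun k => g^[k] a) (Finset.range p : Set ℕ) := by
      have := Function.iterate_injOn_Iio_minimalPeriod (f := g) (x := a)
      rw [hmin] at this
      intro i hi j hj h
      exact this (by simpa using hi) (by simpa using hj) h
    set B := (Finset.range p).image (fun k => g^[k] a) with hB
    have haB : a ∈ B := Finset.mem_image.2 ⟨0, by simpa using hp.pos, rfl⟩
    have hiter : ∀ k, g^[k] a ∈ A := by
      intro k
      induction k with
      | zero => exact ha
      | succ k ih => rw [Function.iterate_succ_apply']; exact hinv _ ih
    have hBA : B ⊆ A := by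
      intro b hb
      obtain ⟨k, -, rfl⟩ := Finset.mem_image.1 hb
      exact hiter k
    have hall : ∀ k, g^[k] a ∈ B := by
      intro k
      refine Finset.mem_image.2 ⟨k % p, by simpa using Nat.mod_lt _ hp.pos, ?_⟩
      have := Function.iterate_mod_minimalPeriod_eq (f := g) (x := a) (n := k)
      rwa [hmin] at this
    have hback : ∀ b, g b ∈ B → b ∈ B := by
      intro b hb
      obtain ⟨k, -, hk⟩ := Finset.mem_image.1 hb
      have h1 : b = g^[p - 1 + k] a := by
        rw [Function.iterate_add_apply]
        rw [hk, ← Function.iterate_succ_apply, Nat.succ_eq_add_one, Nat.sub_add_cancel hp.pos, hg]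
      rw [h1]; exact hall _
    obtain ⟨w, hw⟩ := ih (A \ B).card
      (by rw [← hA]; exact Finset.card_lt_card (Finset.sdiff_ssubset hBA ⟨a, haB⟩)) (A \ B) rfl
      (by
        intro b hb
        rw [Finset.mem_sdiff] at hb ⊢
        exact ⟨hinv _ hb.1, fun h => hb.2 (hback _ h)⟩)
      (fun b hb => hfix b (Finset.mem_sdiff.1 hb).1)
    refine ⟨w + F a, ?_⟩
    rw [← Finset.sum_sdiff hBA, hw, hB, Finset.sum_image hinj]
    simp only [map_add, Finset.sum_add_distrib, hFk]

/-- In the `p`-fold tensor power of a module `M` over a commutative ring `R` (`p` prime),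
with `σ` the cyclic rotation of the tensor factors, the `p`-th tensor power map is
additive up to a transfer: `(x+y)^{⊗p} = x^{⊗p} + y^{⊗p} + ∑_{k<p} σ^k w` for some `w`. -/
theorem stmt_7 {R : Type*} [CommRing R] {M : Type*} [AddCommGroup M] [Module R M]
    (p : ℕ) (hp : p.Prime) (x y : M) :
    ∃ w : ⨂[R] (_ : Fin p), M,
      PiTensorProduct.tprod R (fun _ : Fin p => x + y) =
        PiTensorProduct.tprod R (fun _ : Fin p => x) +
          PiTensorProduct.tprod R (fun _ : Fin p => y) +
          ∑ k ∈ Finset.range p,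
            ((PiTensorProduct.reindex R (fun _ : Fin p => M) (finRotate p)) ^ k) w := by
  obtain ⟨m, rfl⟩ : ∃ m, p = m + 1 := ⟨p - 1, (Nat.sub_add_cancel hp.pos).symm⟩
  have hne : (Finset.univ : Finset (Fin (m + 1))) ≠ ∅ := Finset.univ_nonempty.ne_empty
  let g : Finset (Fin (m + 1)) → Finset (Fin (m + 1)) :=
    fun s => s.map (finRotate (m + 1)).toEmbedding
  have hmem : ∀ s i, i + 1 ∈ g s ↔ i ∈ s := by
    intro s i
    simp only [g]
    rw [← finRotate_apply]
    exact Finset.mem_map' _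
  have hmemk : ∀ (k : ℕ) s i, i + Fin.ofNat (m + 1) k ∈ g^[k] s ↔ i ∈ s := by
    intro k
    induction k with
    | zero =>
      intro s i
      have h0 : Fin.ofNat (m + 1) 0 = 0 := rfl
      rw [h0, add_zero]; rfl
    | succ k ih =>
      intro s i
      have h0 : Fin.ofNat (m + 1) (k + 1) = Fin.ofNat (m + 1) k + 1 := by
        ext; simp [Fin.val_add]
      rw [Function.iterate_succ_apply', h0, ← add_assoc, hmem, ih]
  have hgp : ∀ s, g^[m + 1] s = s := by
    intro s
    ext i
    have := hmemk (m + 1) s i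
    have h0 : Fin.ofNat (m + 1) (m + 1) = 0 := by ext; simp
    rwa [h0, add_zero] at this
  have hgfix : ∀ s, g s = s → s = ∅ ∨ s = Finset.univ := by
    intro s hs
    rcases s.eq_empty_or_nonempty with h | ⟨i, hi⟩
    · exact Or.inl h
    right
    ext j
    have hk : g^[(j - i : Fin (m + 1)).val] s = s := Function.iterate_fixed hs _
    have := hmemk (j - i : Fin (m + 1)).val s i
    have h0 : Fin.ofNat (m + 1) (j - i).val = j - i := by
      ext; exact Nat.mod_eq_of_lt (j - i).isLt
    rw [hk, h0, add_sub_cancel] at this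
    simpa using this.2 hi
  let F : Finset (Fin (m + 1)) → ⨂[R] (_ : Fin (m + 1)), M := fun s =>
    PiTensorProduct.tprod R (s.piecewise (fun _ => x) (fun _ => y))
  have hF : ∀ s, F (g s) =
      (PiTensorProduct.reindex R (fun _ : Fin (m + 1) => M) (finRotate (m + 1))) (F s) := by
    intro s
    simp only [F]
    refine Eq.trans ?_ (PiTensorProduct.reindex_tprod (R := R)
      (s := fun _ : Fin (m + 1) => M) (finRotate (m + 1))
      (s.piecewise (fun _ => x) (fun _ => y))).symm
    congr 1
    ext i
    obtain ⟨j, rfl⟩ := (finRotate (m + 1)).surjective i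
    have := hmem s j
    rw [← finRotate_apply] at this
    simp only [Finset.piecewise, this, Equiv.symm_apply_apply]
  obtain ⟨w, hw⟩ := aux_orbits (m + 1) hp g hgp
    (PiTensorProduct.reindex R (fun _ : Fin (m + 1) => M) (finRotate (m + 1))) F hF _
    ((Finset.univ.erase ∅).erase Finset.univ) rfl
    (by
      intro s hs
      simp only [Finset.mem_erase, Finset.mem_univ, and_true] at hs ⊢
      refine ⟨fun h => hs.1 ?_, fun h => hs.2 ?_⟩
      · ext i
        have := hmem s i
        rw [h] at this
        simpa using this
      · simpa [g] using h)
    (by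
      intro s hs h
      simp only [Finset.mem_erase, Finset.mem_univ, and_true] at hs
      rcases hgfix s h with h | h
      · exact hs.2 h
      · exact hs.1 h)
  refine ⟨w, ?_⟩
  rw [← hw]
  have h1 := (PiTensorProduct.tprod R (s := fun _ : Fin (m + 1) => M)).map_add_univ
    (fun _ => x) (fun _ => y)
  have h2 : PiTensorProduct.tprod R (fun _ : Fin (m + 1) => x + y) = ∑ s, F s := h1
  rw [h2, ← Finset.add_sum_erase _ F (Finset.mem_univ ∅),
    ← Finset.add_sum_erase (Finset.univ.erase ∅) F
      (Finset.mem_erase.2 ⟨hne, Finset.mem_univ _⟩)]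
  have h3 : F ∅ = PiTensorProduct.tprod R (fun _ : Fin (m + 1) => y) := by simp [F]
  have h4 : F Finset.univ = PiTensorProduct.tprod R (fun _ : Fin (m + 1) => x) := by simp [F]
  rw [h3, h4]
  abel
end

section
/- Let S = ℤ[X₀, X₁] be the polynomial ring in two variables over ℤ and let τ be the ring automorphism of S swapping X₀ and X₁. Then the ideal of S generated by the set of transfers {f + τ(f) : f ∈ S} is equal to the ideal of S generated by 2 and X₀ + X₁. -/
/-- In `S = ℤ[X₀, X₁]` with `τ` the automorphism swapping the variables, the ideal
generated by the transfers `f + τ f` equals the ideal generated by `2` and `X₀ + X₁`. -/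
theorem stmt_11 :
    Ideal.span (Set.range fun f : MvPolynomial (Fin 2) ℤ =>
        f + MvPolynomial.rename (Equiv.swap (0 : Fin 2) 1) f) =
      Ideal.span {(2 : MvPolynomial (Fin 2) ℤ),
        MvPolynomial.X 0 + MvPolynomial.X 1} := by
  apply le_antisymm
  · rw [Ideal.span_le]
    rintro _ ⟨f, rfl⟩
    simp only [SetLike.mem_coe]
    induction f using MvPolynomial.induction_on with
    | C a =>
      rw [MvPolynomial.rename_C, Ideal.mem_span_pair]
      exact ⟨MvPolynomial.C a, 0, by ring⟩
    | add p q hp hq =>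
      rw [map_add]
      convert add_mem hp hq using 1
      ring
    | mul_X p i hp =>
      rw [map_mul, MvPolynomial.rename_X]
      rw [Ideal.mem_span_pair] at hp ⊢
      obtain ⟨a, b, h⟩ := hp
      generalize MvPolynomial.rename (Equiv.swap (0 : Fin 2) 1) p = q at *
      fin_cases i
      · refine ⟨a * MvPolynomial.X 0 - q * MvPolynomial.X 0, b * MvPolynomial.X 0 + q, ?_⟩
        simp
        linear_combination MvPolynomial.X 0 * h
      · refine ⟨a * MvPolynomial.X 1 - q * MvPolynomial.X 1, b * MvPolynomial.X 1 + q, ?_⟩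
        simp
        linear_combination MvPolynomial.X 1 * h
  · rw [Ideal.span_le]
    rintro x (rfl | rfl)
    · apply Ideal.subset_span
      exact ⟨1, by simp only [map_one]; norm_num⟩
    · apply Ideal.subset_span
      exact ⟨MvPolynomial.X 0, by simp⟩
end

section
/- Let S = ℤ[X₀, X₁] and let I ⊆ S be the ideal generated by 2 and X₀ + X₁. Then the kernel of the ring homomorphism ℤ[x] → S/I sending the variable x to the class of X₀·X₁ is the ideal of ℤ[x] generated by 2. -/
/-- The kernel of the ring homomorphism `ℤ[x] → ℤ[X₀,X₁]/(2, X₀ + X₁)` sending `x` to the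
class of `X₀·X₁` is the ideal `(2)`. -/
theorem stmt_12 :
    RingHom.ker (Polynomial.aeval (R := ℤ)
        (Ideal.Quotient.mk (Ideal.span {(2 : MvPolynomial (Fin 2) ℤ),
            MvPolynomial.X 0 + MvPolynomial.X 1})
          (MvPolynomial.X 0 * MvPolynomial.X 1))) =
      Ideal.span {(2 : Polynomial ℤ)} := by
  have h20 : (2 : Polynomial (ZMod 2)) = 0 := CharTwo.two_eq_zero
  apply le_antisymm
  · intro p hp
    rw [RingHom.mem_ker] at hp
    let ψ : MvPolynomial (Fin 2) ℤ →+* Polynomial (ZMod 2) :=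
      MvPolynomial.eval₂Hom (Int.castRingHom _) (fun _ => Polynomial.X)
    have hI : ∀ a ∈ Ideal.span {(2 : MvPolynomial (Fin 2) ℤ),
            MvPolynomial.X 0 + MvPolynomial.X 1}, ψ a = 0 := by
      intro a ha
      have : Ideal.span {(2 : MvPolynomial (Fin 2) ℤ),
            MvPolynomial.X 0 + MvPolynomial.X 1} ≤ RingHom.ker ψ := by
        rw [Ideal.span_le]
        rintro b (rfl | rfl)
        · exact (map_ofNat ψ 2).trans h20
        · simp [RingHom.mem_ker, ψ, CharTwo.add_self_eq_zero]
      exact this ha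
    let φ := Ideal.Quotient.lift _ ψ hI
    have key : (φ.comp (Polynomial.aeval (R := ℤ)
        (Ideal.Quotient.mk (Ideal.span {(2 : MvPolynomial (Fin 2) ℤ),
            MvPolynomial.X 0 + MvPolynomial.X 1})
          (MvPolynomial.X 0 * MvPolynomial.X 1))).toRingHom) =
        ((Polynomial.expand (ZMod 2) 2).toRingHom.comp
          (Polynomial.mapRingHom (Int.castRingHom (ZMod 2)))) := by
      apply Polynomial.ringHom_ext'
      · exact RingHom.ext_int _ _
      · simp [φ, ψ, pow_two]
    have h := congrArg (fun f => f p) key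
    have h0 : Polynomial.expand (ZMod 2) 2 (p.map (Int.castRingHom (ZMod 2))) = 0 := by
      refine h.symm.trans ?_
      change φ (Polynomial.aeval _ p) = 0
      rw [hp, map_zero]
    rw [Polynomial.expand_eq_zero (by norm_num)] at h0
    rw [Ideal.mem_span_singleton]
    have : (Polynomial.C (2:ℤ)) ∣ p := by
      rw [Polynomial.C_dvd_iff_dvd_coeff]
      intro i
      have := congrArg (fun q => q.coeff i) h0
      simp only [Polynomial.coeff_map, Polynomial.coeff_zero, eq_intCast] at this
      exact (ZMod.intCast_zmod_eq_zero_iff_dvd _ 2).1 this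
    simpa using this
  · rw [Ideal.span_singleton_le_iff_mem, RingHom.mem_ker, map_ofNat]
    exact Ideal.Quotient.eq_zero_iff_mem.2 (Ideal.subset_span (by simp))
end

section
/- Let m ≥ 1 and let f be a polynomial in m variables over ℚ such that: (i) f is additive, i.e., f(x₁+y₁, …, x_m+y_m) = f(x₁, …, x_m) + f(y₁, …, y_m) as an identity of polynomials in 2m variables; (ii) f is multiplicative, i.e., f(x₁·y₁, …, x_m·y_m) = f(x₁, …, x_m)·f(y₁, …, y_m) as an identity of polynomials in 2m variables; and (iii) f(1, 1, …, 1) = 1. Then f = X_i for some i, i.e., f is one of the coordinate variables. -/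
open MvPolynomial

/-- A polynomial `f ∈ ℚ[X₁,…,X_m]` (`m ≥ 1`) that is additive, multiplicative, and unital
(as polynomial identities in `2m` variables, resp. on evaluation at `(1,…,1)`) is one of
the coordinate variables `X i`. -/
theorem stmt_13 (m : ℕ) (hm : 1 ≤ m) (f : MvPolynomial (Fin m) ℚ)
    (hadd : aeval (fun i : Fin m =>
          (X (Sum.inl i) + X (Sum.inr i) : MvPolynomial (Fin m ⊕ Fin m) ℚ)) f =
        aeval (fun i : Fin m => (X (Sum.inl i) : MvPolynomial (Fin m ⊕ Fin m) ℚ)) f +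
          aeval (fun i : Fin m => (X (Sum.inr i) : MvPolynomial (Fin m ⊕ Fin m) ℚ)) f)
    (hmul : aeval (fun i : Fin m =>
          (X (Sum.inl i) * X (Sum.inr i) : MvPolynomial (Fin m ⊕ Fin m) ℚ)) f =
        aeval (fun i : Fin m => (X (Sum.inl i) : MvPolynomial (Fin m ⊕ Fin m) ℚ)) f *
          aeval (fun i : Fin m => (X (Sum.inr i) : MvPolynomial (Fin m ⊕ Fin m) ℚ)) f)
    (hone : eval (fun _ : Fin m => (1 : ℚ)) f = 1) :
    ∃ i : Fin m, f = X i := by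
  have hA : ∀ x y : Fin m → ℚ, eval (x + y) f = eval x f + eval y f := by
    intro x y
    have h := congrArg (aeval (Sum.elim x y) : MvPolynomial (Fin m ⊕ Fin m) ℚ →ₐ[ℚ] ℚ) hadd
    rw [map_add] at h
    simp only [← AlgHom.comp_apply, comp_aeval, map_add, aeval_X, Sum.elim_inl, Sum.elim_inr] at h
    exact h
  have hM : ∀ x y : Fin m → ℚ, eval (x * y) f = eval x f * eval y f := by
    intro x y
    have h := congrArg (aeval (Sum.elim x y) : MvPolynomial (Fin m ⊕ Fin m) ℚ →ₐ[ℚ] ℚ) hmul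
    rw [map_mul] at h
    simp only [← AlgHom.comp_apply, comp_aeval, map_mul, aeval_X, Sum.elim_inl, Sum.elim_inr] at h
    exact h
  let L : (Fin m → ℚ) →ₗ[ℚ] ℚ :=
    (AddMonoidHom.mk' (fun x : Fin m → ℚ => eval x f) hA).toRatLinearMap
  have hL : ∀ x, L x = eval x f := fun x => rfl
  have hex : ∃ i : Fin m, L (Pi.single i 1) ≠ 0 := by
    by_contra! hc
    have h0 : L = 0 := by
      apply LinearMap.pi_ext'
      intro i
      ext
      simpa using hc i
    have h1 : L (fun _ => 1) = 1 := hone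
    rw [h0] at h1
    simp at h1
  obtain ⟨i, hi⟩ := hex
  refine ⟨i, MvPolynomial.funext fun x => ?_⟩
  rw [eval_X]
  have h1 : x * Pi.single i 1 = x i • (Pi.single i 1 : Fin m → ℚ) := by
    ext j
    by_cases hj : j = i
    · subst hj; simp
    · simp [hj]
  have h2 := hM x (Pi.single i 1)
  rw [h1, ← hL, ← hL, ← hL, map_smul, smul_eq_mul] at h2
  exact (mul_right_cancel₀ hi h2).symm
end
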